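/- arXiv:2207.11587 — 2 statements merged into one kernel-verified Lean document; each statement's English description precedes it below -/
import Mathlib

section
/- Let A be a normal uniform algebra on a compact Hausdorff space X and let x₁, …, xₙ be points of X. Then (i) the uniform algebra B = A_{x₁} ∩ ⋯ ∩ A_{xₙ} is strongly regular at each of the points x₁, …, xₙ, and (ii) at each point of X where A has bounded relative units, B also has bounded relative units. -/
open WeakDual Topology

set_option synthInstance.maxHeartbeats 400000
set_option maxHeartbeats 1000000
set_option linter.unusedSectionVars false

noncomputable section

variable {X : Type*} [TopologicalSpace X]

/-- A uniform algebra on `X`: a closed point-separating subalgebra of `C(X, ℂ)`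
(it automatically contains the constant functions, being a subalgebra). -/
def IsUniformAlgebra (A : Subalgebra ℂ C(X, ℂ)) : Prop :=
  IsClosed (A : Set C(X, ℂ)) ∧ ∀ x y : X, x ≠ y → ∃ f ∈ A, f x ≠ f y

/-- The character of evaluation at a point `x ∈ X`. -/
def evalChar (A : Subalgebra ℂ C(X, ℂ)) (x : X) : characterSpace ℂ A :=
  ⟨{ toFun := fun f => (f : C(X, ℂ)) x
     map_add' := fun f g => rfl
     map_smul' := fun c f => rfl
     cont := (ContinuousEvalConst.continuous_eval_const x).comp continuous_subtype_val },
   ⟨by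
      intro h
      have h1 : ((1 : A) : C(X, ℂ)) x = 0 := DFunLike.congr_fun h 1
      simp at h1,
    fun f g => rfl⟩⟩

/-- The continuous linear functional on `A` underlying a character,
as an element of the normed dual of `A`. -/
def charDual {A : Type*} [NonUnitalNonAssocSemiring A] [TopologicalSpace A] [Module ℂ A]
    (φ : characterSpace ℂ A) : A →L[ℂ] ℂ := φ.1

/-- The set `J_φ` of elements of `A` whose Gelfand transform vanishes on a
neighborhood of `φ` in the maximal ideal space of `A`. -/
def vanishNearSet (A : Subalgebra ℂ C(X, ℂ)) (φ : characterSpace ℂ A) : Set A :=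
  {f | ∃ U ∈ 𝓝 φ, ∀ ψ ∈ U, ψ f = 0}

/-- `A` is normal on `X`: disjoint closed sets are separated by a `0`-`1` valued
pair of values of some function in `A`. -/
def IsNormalOn (A : Subalgebra ℂ C(X, ℂ)) : Prop :=
  ∀ K₀ K₁ : Set X, IsClosed K₀ → IsClosed K₁ → Disjoint K₀ K₁ →
    ∃ f ∈ A, (∀ x ∈ K₀, f x = 0) ∧ (∀ x ∈ K₁, f x = 1)

/-- `A` is strongly regular at `x`: `J_x` is dense in `M_x`. -/
def StronglyRegularAt (A : Subalgebra ℂ C(X, ℂ)) (x : X) : Prop :=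
  {f : A | (f : C(X, ℂ)) x = 0} ⊆ closure (vanishNearSet A (evalChar A x))

/-- `d` is a point derivation sequence of order `n` at `φ`: `d⁰ = φ` and the
Leibniz identities hold for `1 ≤ k ≤ n` (linearity/continuity of the `d k` is
imposed by the type at which this is used). -/
def IsDerivSeq {A : Type*} [Mul A] (φ : A → ℂ) (n : ℕ∞) (d : ℕ → A → ℂ) : Prop :=
  (∀ f, d 0 f = φ f) ∧
  ∀ k : ℕ, 1 ≤ k → (k : ℕ∞) ≤ n → ∀ f g,
    d k (f * g) = ∑ j ∈ Finset.range (k + 1), d j f * d (k - j) g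

variable [CompactSpace X]

/-- `A` has bounded relative units at `x`. -/
def HasBoundedRelativeUnits (A : Subalgebra ℂ C(X, ℂ)) (x : X) : Prop :=
  ∃ C : ℝ, 0 < C ∧ ∀ K : Set X, IsCompact K → x ∉ K →
    ∃ f : A, f ∈ vanishNearSet A (evalChar A x) ∧
      (∀ y ∈ K, (f : C(X, ℂ)) y = 1) ∧ ‖(f : C(X, ℂ))‖ ≤ C

/-- `x` is a generalized peak point for `A`. -/
def IsGeneralizedPeakPoint (A : Subalgebra ℂ C(X, ℂ)) (x : X) : Prop :=
  ∀ U ∈ 𝓝 x, ∃ f ∈ A, f x = 1 ∧ ‖f‖ = 1 ∧ ∀ y ∉ U, ‖f y‖ < 1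

/-- `P` is a Gleason part for `A`: the set of all characters at dual-norm
distance `< 2` from some fixed character. -/
def IsGleasonPart (A : Subalgebra ℂ C(X, ℂ)) (P : Set (characterSpace ℂ A)) : Prop :=
  ∃ φ : characterSpace ℂ A, P = {ψ | ‖charDual φ - charDual ψ‖ < 2}

/-- The carrier set of Feinstein's algebra `A_x = cl(J_x) ⊕ ℂ·1`. -/
def feinsteinSet (A : Subalgebra ℂ C(X, ℂ)) (x : X) : Set C(X, ℂ) :=
  {h | ∃ g ∈ closure ((fun f : A => (f : C(X, ℂ))) '' vanishNearSet A (evalChar A x)),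
    ∃ c : ℂ, h = g + algebraMap ℂ C(X, ℂ) c}

section NormalAlgebra

variable [T2Space X] {A : Subalgebra ℂ C(X, ℂ)}

/-- A character sending `f` to `1` annihilates every `h` supported where `‖f‖ ≤ 1 / 2`. -/
lemma character_eq_zero_of_support (φ : characterSpace ℂ A) {f h : A} (hf : φ f = 1)
    (hh : ∀ z, (h : C(X, ℂ)) z = 0 ∨ ‖(f : C(X, ℂ)) z‖ ≤ 1 / 2) : φ h = 0 := by
  have hconst (n : ℕ) : φ (h * f ^ n) = φ h := by rw [map_mul, map_pow, hf, one_pow, mul_one]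
  have hnorm (n : ℕ) : ‖(h : C(X, ℂ)) * (f : C(X, ℂ)) ^ n‖ ≤ ‖(h : C(X, ℂ))‖ * (1 / 2) ^ n := by
    refine (ContinuousMap.norm_le _ (by positivity)).2 fun z => ?_
    rw [ContinuousMap.mul_apply, ContinuousMap.pow_apply, norm_mul, norm_pow]
    rcases hh z with hz | hz
    · rw [hz, norm_zero, zero_mul]
      positivity
    · exact mul_le_mul ((h : C(X, ℂ)).norm_coe_le_norm z)
        (pow_le_pow_left₀ (norm_nonneg _) hz n) (by positivity) (norm_nonneg _)
  have hpow : Filter.Tendsto (fun n : ℕ => ‖(h : C(X, ℂ))‖ * (1 / 2 : ℝ) ^ n)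
      Filter.atTop (𝓝 0) := by
    rw [← mul_zero ‖(h : C(X, ℂ))‖]
    exact (tendsto_pow_atTop_nhds_zero_of_lt_one (by norm_num) (by norm_num)).const_mul _
  have hlim : Filter.Tendsto (fun n : ℕ => h * f ^ n) Filter.atTop (𝓝 0) :=
    tendsto_subtype_rng.2 (squeeze_zero_norm hnorm hpow)
  have hφ := ((map_continuous φ).tendsto 0).comp hlim
  rw [map_zero, show φ ∘ (fun n : ℕ => h * f ^ n) = fun _ => φ h from funext hconst] at hφ
  exact tendsto_nhds_unique tendsto_const_nhds hφ

/-- Separating a point from a closed set by a function of a normal algebra that vanishes near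
the point. -/
lemma IsNormalOn.exists_eventually_zero (hA : IsNormalOn A) {x : X} {U : Set X} (hU : U ∈ 𝓝 x) :
    ∃ g : A, (∀ᶠ z in 𝓝 x, (g : C(X, ℂ)) z = 0) ∧ ∀ z ∉ U, (g : C(X, ℂ)) z = 1 := by
  obtain ⟨K, hK, hKc, hKU⟩ := exists_mem_nhds_isClosed_subset (interior_mem_nhds.2 hU)
  obtain ⟨g, hgA, hg0, hg1⟩ := hA K (interior U)ᶜ hKc isOpen_interior.isClosed_compl
    (Set.disjoint_compl_right_iff_subset.2 hKU)
  exact ⟨⟨g, hgA⟩, Filter.mem_of_superset hK hg0,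
    fun z hz => hg1 z fun h => hz (interior_subset h)⟩

/-- A normal algebra is natural: every character is a point evaluation. -/
lemma IsNormalOn.exists_eq_evalChar (hA : IsNormalOn A) (φ : characterSpace ℂ A) :
    ∃ x, φ = evalChar A x := by
  by_contra! hne
  have key (x : X) : ∃ g : A, (∀ᶠ z in 𝓝 x, (g : C(X, ℂ)) z = 0) ∧ φ g = 1 := by
    obtain ⟨f, hf⟩ := DFunLike.ne_iff.1 (hne x)
    change φ f ≠ (f : C(X, ℂ)) x at hf
    set a := (f : C(X, ℂ)) x with ha
    set k : A := (φ f - a)⁻¹ • (f - algebraMap ℂ A a) with hk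
    have hkφ : φ k = 1 := by
      rw [hk, map_smul, map_sub, AlgHomClass.commutes]
      exact inv_mul_cancel₀ (sub_ne_zero.2 hf)
    have hkx : (k : C(X, ℂ)) x = 0 := by
      change (φ f - a)⁻¹ * ((f : C(X, ℂ)) x - a) = 0
      simp [ha]
    have hU : {z | ‖(k : C(X, ℂ)) z‖ ≤ 1 / 2} ∈ 𝓝 x := by
      have : Filter.Tendsto (fun z => ‖(k : C(X, ℂ)) z‖) (𝓝 x) (𝓝 0) := by
        simpa [hkx] using ((map_continuous (k : C(X, ℂ))).norm.tendsto x)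
      exact this.eventually_le_const (by norm_num)
    obtain ⟨g, hg0, hg1⟩ := hA.exists_eventually_zero hU
    refine ⟨g, hg0, ?_⟩
    have h0 : φ (1 - g) = 0 := by
      refine character_eq_zero_of_support φ hkφ fun z => ?_
      by_cases hz : ‖(k : C(X, ℂ)) z‖ ≤ 1 / 2
      · exact Or.inr hz
      · left
        change 1 - (g : C(X, ℂ)) z = 0
        rw [hg1 z hz, sub_self]
    rw [map_sub, map_one, sub_eq_zero] at h0
    exact h0.symm
  choose g hg0 hg1 using key
  obtain ⟨t, -, ht⟩ := isCompact_univ.elim_nhds_subcover (fun x => {z | (g x : C(X, ℂ)) z = 0})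
    fun x _ => hg0 x
  have hprod : ∏ x ∈ t, g x = 0 := by
    ext z
    obtain ⟨x, hx, hz⟩ := Set.mem_iUnion₂.1 (ht (Set.mem_univ z))
    change (evalChar A z) (∏ x ∈ t, g x) = 0
    rw [map_prod]
    exact Finset.prod_eq_zero hx hz
  have := congrArg φ hprod
  simp [map_prod, hg1] at this

lemma continuous_evalChar : Continuous (evalChar A) :=
  continuous_induced_rng.2 (WeakDual.continuous_of_continuous_eval fun f =>
    map_continuous (f : C(X, ℂ)))

lemma IsNormalOn.injective_evalChar (hA : IsNormalOn A) : Function.Injective (evalChar A) := by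
  intro x y hxy
  by_contra hne
  obtain ⟨f, hfA, h0, h1⟩ := hA {x} {y} isClosed_singleton isClosed_singleton (by simpa using hne)
  have h : f x = f y := DFunLike.congr_fun hxy (⟨f, hfA⟩ : A)
  rw [h0 x rfl, h1 y rfl] at h
  exact zero_ne_one h

/-- For a normal algebra, `J_x` consists of the functions vanishing near `x` in `X`. -/
lemma IsNormalOn.mem_vanishNearSet_iff (hA : IsNormalOn A) {x : X} {f : A} :
    f ∈ vanishNearSet A (evalChar A x) ↔ ∀ᶠ z in 𝓝 x, (f : C(X, ℂ)) z = 0 := by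
  constructor
  · rintro ⟨U, hU, h⟩
    exact Filter.mem_of_superset (continuous_evalChar.continuousAt hU) fun z hz => h _ hz
  · intro h
    have hemb : IsClosedEmbedding (evalChar A) :=
      continuous_evalChar.isClosedEmbedding hA.injective_evalChar
    obtain ⟨V, hV, hVo, hxV⟩ := eventually_nhds_iff.1 h
    refine ⟨(evalChar A '' Vᶜ)ᶜ,
      (hemb.isClosedMap _ hVo.isClosed_compl).isOpen_compl.mem_nhds ?_, ?_⟩
    · rintro ⟨z, hz, hzx⟩
      exact hz (hA.injective_evalChar hzx ▸ hxV)
    · intro ψ hψ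
      obtain ⟨z, rfl⟩ := hA.exists_eq_evalChar ψ
      by_contra hne
      exact hψ ⟨z, fun hz => hne (hV z hz), rfl⟩

lemma IsNormalOn.mem_feinsteinSet_of_eventually_eq (hA : IsNormalOn A) {x : X} {f : C(X, ℂ)}
    (hf : f ∈ A) {c : ℂ} (h : ∀ᶠ z in 𝓝 x, f z = c) : f ∈ feinsteinSet A x := by
  refine ⟨f - algebraMap ℂ C(X, ℂ) c, subset_closure
    ⟨⟨f, hf⟩ - algebraMap ℂ A c, hA.mem_vanishNearSet_iff.2 ?_, rfl⟩, c, by simp⟩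
  filter_upwards [h] with z hz
  change f z - c = 0
  rw [hz, sub_self]

lemma IsNormalOn.mem_closure_of_mem_feinsteinSet (hA : IsNormalOn A) {x : X} {f : C(X, ℂ)}
    (hf : f ∈ feinsteinSet A x) (hfx : f x = 0) :
    f ∈ closure {g : C(X, ℂ) | g ∈ A ∧ ∀ᶠ z in 𝓝 x, g z = 0} := by
  obtain ⟨g, hg, c, rfl⟩ := hf
  have hsub : (fun f : A => (f : C(X, ℂ))) '' vanishNearSet A (evalChar A x) ⊆
      {g : C(X, ℂ) | g ∈ A ∧ ∀ᶠ z in 𝓝 x, g z = 0} := by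
    rintro _ ⟨k, hk, rfl⟩
    exact ⟨k.2, hA.mem_vanishNearSet_iff.1 hk⟩
  have hg' := closure_mono hsub hg
  have hgx : g x = 0 := by
    have hclosed : IsClosed {g : C(X, ℂ) | g x = 0} :=
      isClosed_eq (ContinuousEvalConst.continuous_eval_const x) continuous_const
    exact closure_minimal (fun k hk => hk.2.self_of_nhds) hclosed hg'
  have hc : c = 0 := by
    change g x + c = 0 at hfx
    simpa [hgx] using hfx
  simpa [hc] using hg'

/-- A normal algebra separates disjoint closed sets by functions that are constant near each of
their points. -/
lemma IsNormalOn.exists_eventually (hA : IsNormalOn A) {K₀ K₁ : Set X} (h₀ : IsClosed K₀)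
    (h₁ : IsClosed K₁) (hd : Disjoint K₀ K₁) :
    ∃ f ∈ A, (∀ x ∈ K₀, ∀ᶠ z in 𝓝 x, f z = 0) ∧ (∀ x ∈ K₁, ∀ᶠ z in 𝓝 x, f z = 1) := by
  obtain ⟨U, hUo, hKU, hUc⟩ := normal_exists_closure_subset h₀ h₁.isOpen_compl
    (Set.disjoint_left.1 hd)
  obtain ⟨V, hVo, hKV, hVc⟩ := normal_exists_closure_subset h₁ isClosed_closure.isOpen_compl
    (Set.subset_compl_comm.1 hUc)
  obtain ⟨f, hfA, hf0, hf1⟩ := hA (closure U) (closure V) isClosed_closure isClosed_closure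
    (Set.disjoint_left.2 fun z hz hz' => hVc hz' hz)
  exact ⟨f, hfA,
    fun x hx => Filter.mem_of_superset (hUo.mem_nhds (hKU hx)) fun z hz => hf0 z (subset_closure hz),
    fun x hx => Filter.mem_of_superset (hVo.mem_nhds (hKV hx)) fun z hz => hf1 z (subset_closure hz)⟩

end NormalAlgebra

/-- For a normal uniform algebra `A` and points `x₁, …, xₙ` of `X`,
the algebra `B = A_{x₁} ∩ ⋯ ∩ A_{xₙ}` is strongly regular at each `xᵢ`, and has bounded
relative units at each point where `A` does. -/
theorem feinstein_algebra_inter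
    {X : Type*} [TopologicalSpace X] [CompactSpace X] [T2Space X]
    (A : Subalgebra ℂ C(X, ℂ)) (hA : IsUniformAlgebra A) (hnormal : IsNormalOn A)
    (n : ℕ) (x : Fin n → X)
    (B : Subalgebra ℂ C(X, ℂ))
    (hB : (B : Set C(X, ℂ)) = ⋂ i : Fin n, feinsteinSet A (x i)) :
    (∀ i : Fin n, StronglyRegularAt B (x i)) ∧
    (∀ y : X, HasBoundedRelativeUnits A y → HasBoundedRelativeUnits B y) := by
  have hmemB {f : C(X, ℂ)} : f ∈ B ↔ ∀ i, f ∈ feinsteinSet A (x i) := by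
    rw [← SetLike.mem_coe, hB, Set.mem_iInter]
  have hBmem {f : C(X, ℂ)} (hf : f ∈ A) (h : ∀ i, ∃ c, ∀ᶠ z in 𝓝 (x i), f z = c) : f ∈ B :=
    hmemB.2 fun i => hnormal.mem_feinsteinSet_of_eventually_eq hf (h i).choose_spec
  have hfin : (Set.range x).Finite := Set.finite_range x
  have hBnormal : IsNormalOn B := by
    intro K₀ K₁ h₀ h₁ hd
    obtain ⟨f, hfA, hf0, hf1⟩ := hnormal.exists_eventually
      (h₀.union (hfin.subset (Set.sdiff_subset (t := K₁))).isClosed) h₁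
      (Set.disjoint_union_left.2 ⟨hd, Set.disjoint_sdiff_left⟩)
    refine ⟨f, hBmem hfA fun i => ?_, fun z hz => (hf0 z (Or.inl hz)).self_of_nhds,
      fun z hz => (hf1 z hz).self_of_nhds⟩
    by_cases hi : x i ∈ K₁
    · exact ⟨1, hf1 _ hi⟩
    · exact ⟨0, hf0 _ (Or.inr ⟨⟨i, rfl⟩, hi⟩)⟩
  refine ⟨fun i f hfx => ?_, ?_⟩
  · change (f : C(X, ℂ)) (x i) = 0 at hfx
    have hcl := hnormal.mem_closure_of_mem_feinsteinSet (hmemB.1 f.2 i) hfx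
    obtain ⟨e, heA, he0, he1⟩ := hnormal.exists_eventually
      (hfin.subset (Set.sdiff_subset (t := {x i}))).isClosed isClosed_singleton
      Set.disjoint_sdiff_left
    have he (j : Fin n) : x j = x i ∨ ∀ᶠ z in 𝓝 (x j), e z = 0 := by
      by_cases hj : x j = x i
      · exact Or.inl hj
      · exact Or.inr (he0 _ ⟨⟨j, rfl⟩, hj⟩)
    have heB : e ∈ B := hBmem heA fun j => by
      rcases he j with hj | hj
      · exact ⟨1, hj ▸ he1 _ rfl⟩
      · exact ⟨0, hj⟩
    rw [closure_subtype]
    have hmap : Set.MapsTo (fun g : C(X, ℂ) => e * g + (1 - e) * f)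
        {g | g ∈ A ∧ ∀ᶠ z in 𝓝 (x i), g z = 0}
        (Subtype.val '' vanishNearSet B (evalChar B (x i))) := by
      rintro g ⟨hgA, hg⟩
      have hegB : e * g ∈ B := hBmem (mul_mem heA hgA) fun j => by
        refine ⟨0, ?_⟩
        rcases he j with hj | hj
        · rw [hj]
          filter_upwards [hg] with z hz
          simp [hz]
        · filter_upwards [hj] with z hz
          simp [hz]
      refine ⟨⟨_, add_mem hegB (mul_mem (sub_mem (one_mem B) heB) f.2)⟩,
        hBnormal.mem_vanishNearSet_iff.2 ?_, rfl⟩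
      filter_upwards [hg, he1 _ rfl] with z hz hez
      simp [hz, hez]
    have := map_mem_closure (by fun_prop) hcl hmap
    convert this using 1
    ring
  · rintro y ⟨C, hC, h⟩
    refine ⟨C, hC, fun K hK hyK => ?_⟩
    have hL : IsClosed (K ∪ Set.range x \ {y}) :=
      hK.isClosed.union (hfin.subset Set.sdiff_subset).isClosed
    have hyL : y ∉ K ∪ Set.range x \ {y} := by simp [hyK]
    obtain ⟨V, hVo, hLV, hVc⟩ := normal_exists_closure_subset hL isOpen_compl_singleton
      (Set.subset_compl_singleton_iff.2 hyL)
    obtain ⟨f, hfJ, hf1, hfC⟩ := h (closure V) isClosed_closure.isCompact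
      fun hy => hVc hy rfl
    rw [hnormal.mem_vanishNearSet_iff] at hfJ
    have hfB : (f : C(X, ℂ)) ∈ B := hBmem f.2 fun i => by
      by_cases hi : x i = y
      · exact ⟨0, hi ▸ hfJ⟩
      · exact ⟨1, Filter.mem_of_superset (hVo.mem_nhds (hLV (Or.inr ⟨⟨i, rfl⟩, hi⟩)))
          fun z hz => hf1 z (subset_closure hz)⟩
    exact ⟨⟨f, hfB⟩, hBnormal.mem_vanishNearSet_iff.2 hfJ,
      fun z hz => hf1 z (subset_closure (hLV (Or.inl hz))), hfC⟩

end
end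

section
/- Let A be a uniform algebra, let J be a primary ideal in A, and let E = {f² : f ∈ J}. If E is dense in J, then each point of the maximal ideal space of A is a one-point Gleason part; that is, ‖φ − ψ‖ = 2 in the dual norm for all distinct characters φ, ψ of A. -/
open WeakDual Topology

set_option synthInstance.maxHeartbeats 400000
set_option maxHeartbeats 1000000
set_option linter.unusedSectionVars false

noncomputable section

variable {X : Type*} [TopologicalSpace X]

variable [CompactSpace X]

lemma IsUniformAlgebra.completeSpace {A : Subalgebra ℂ C(X, ℂ)} (hA : IsUniformAlgebra A) :
    CompleteSpace A :=
  hA.1.completeSpace_coe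

lemma norm_apply_le_norm_of_character {A : Subalgebra ℂ C(X, ℂ)} (hA : IsUniformAlgebra A)
    (φ : characterSpace ℂ A) (f : A) : ‖φ f‖ ≤ ‖f‖ := by
  have := hA.completeSpace
  have h1 : ‖(1 : A)‖ ≤ 1 :=
    (ContinuousMap.norm_le (1 : C(X, ℂ)) zero_le_one).2 fun x => by simp
  exact (AlgHom.norm_apply_le_self_mul_norm_one φ f).trans
    (mul_le_of_le_one_right (norm_nonneg f) h1)

lemma norm_charDual_sub_le_two {A : Subalgebra ℂ C(X, ℂ)} (hA : IsUniformAlgebra A)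
    (φ ψ : characterSpace ℂ A) : ‖charDual φ - charDual ψ‖ ≤ 2 := by
  refine ContinuousLinearMap.opNorm_le_bound _ zero_le_two fun f => ?_
  have hφ := norm_apply_le_norm_of_character hA φ f
  have hψ := norm_apply_le_norm_of_character hA ψ f
  calc ‖φ f - ψ f‖ ≤ ‖φ f‖ + ‖ψ f‖ := norm_sub_le _ _
    _ ≤ 2 * ‖f‖ := by linarith

lemma norm_lt_one_of_norm_pow_lt_one {f : C(X, ℂ)} {k : ℕ}
    (h : ‖f ^ k‖ < 1) : ‖f‖ < 1 := by
  refine (ContinuousMap.norm_lt_iff f one_pos).2 fun x => ?_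
  by_contra! hx
  have hpow : ‖f x‖ ^ k < 1 := by
    simpa using ((f ^ k).norm_coe_le_norm x).trans_lt h
  exact hpow.not_ge (one_le_pow₀ hx)

/-- The disc automorphism `z ↦ (z - s) / (1 - s z)` maps the unit disc into itself. -/
lemma norm_sub_le_norm_one_sub_mul {s : ℝ} (hs0 : 0 ≤ s) (hs1 : s < 1) {z : ℂ} (hz : ‖z‖ < 1) :
    ‖z - s‖ ≤ ‖1 - s * z‖ := by
  have hz2 : z.re * z.re + z.im * z.im < 1 := by
    rw [← Complex.normSq_apply, Complex.normSq_eq_norm_sq]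
    nlinarith [norm_nonneg z]
  refine le_of_sq_le_sq ?_ (norm_nonneg _)
  rw [← Complex.normSq_eq_norm_sq, ← Complex.normSq_eq_norm_sq, Complex.normSq_apply,
    Complex.normSq_apply]
  simp only [Complex.sub_re, Complex.sub_im, Complex.ofReal_re, Complex.ofReal_im, Complex.one_re,
    Complex.one_im, Complex.mul_re, Complex.mul_im]
  nlinarith [mul_nonneg (sub_nonneg.2 hz2.le) (show 0 ≤ 1 - s * s by nlinarith)]

lemma norm_moebius_sub_le_norm_charDual_sub {A : Subalgebra ℂ C(X, ℂ)} (hA : IsUniformAlgebra A)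
    (φ ψ : characterSpace ℂ A) {f : A} (hf : ‖f‖ < 1) {s : ℝ} (hs0 : 0 ≤ s) (hs1 : s < 1) :
    ‖(φ f - s) / (1 - s * φ f) - (ψ f - s) / (1 - s * ψ f)‖ ≤ ‖charDual φ - charDual ψ‖ := by
  have := hA.completeSpace
  have hsf : ‖(s : ℂ) • f‖ < 1 := by
    rw [norm_smul, Complex.norm_real, Real.norm_of_nonneg hs0]
    nlinarith [norm_nonneg f]
  obtain ⟨v, hv⟩ := (isUnit_one_sub_of_norm_lt_one hsf).exists_left_inv
  set g : A := v * (f - algebraMap ℂ A s) with hg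
  have hgf : g * (1 - (s : ℂ) • f) = f - algebraMap ℂ A s := by
    rw [hg, mul_right_comm, hv, one_mul]
  have hchar : ∀ χ : characterSpace ℂ A, χ g = (χ f - s) / (1 - s * χ f) := by
    intro χ
    have h1 : χ v * (1 - s * χ f) = 1 := by
      have := congrArg χ hv
      rwa [map_mul, map_sub, map_one, map_smul, smul_eq_mul] at this
    have h2 : χ g * (1 - s * χ f) = χ f - s := by
      have := congrArg χ hgf
      rwa [map_mul, map_sub, map_sub, map_one, map_smul, AlgHomClass.commutes, smul_eq_mul] at this
    rw [eq_div_iff (right_ne_zero_of_mul_eq_one h1), h2]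
  have hgn : ‖g‖ ≤ 1 := by
    refine (ContinuousMap.norm_le (g : C(X, ℂ)) zero_le_one).2 fun x => ?_
    have hx : ‖(f : C(X, ℂ)) x‖ < 1 := ((f : C(X, ℂ)).norm_coe_le_norm x).trans_lt hf
    have h1 : evalChar A x v * (1 - s * (f : C(X, ℂ)) x) = 1 := by
      have := congrArg (evalChar A x) hv
      rwa [map_mul, map_sub, map_one, map_smul, smul_eq_mul] at this
    change ‖evalChar A x g‖ ≤ 1
    rw [hchar, norm_div]
    exact div_le_one_of_le₀ (norm_sub_le_norm_one_sub_mul hs0 hs1 hx) (norm_nonneg _)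
  rw [← hchar, ← hchar]
  exact (charDual φ - charDual ψ).unit_le_opNorm g hgn

lemma exists_moebius_difference_gt {c : ℝ} (hc : c < 2) :
    ∃ s : ℝ, 0 ≤ s ∧ s < 1 ∧ ∃ δ : ℝ, 0 < δ ∧ ∀ z w : ℂ, ‖z - 1‖ < δ → ‖w‖ < δ →
      c < ‖(z - s) / (1 - s * z) - (w - s) / (1 - s * w)‖ := by
  obtain ⟨s, hs, hs1⟩ := exists_between (max_lt one_pos (show c - 1 < 1 by linarith))
  have hs0 : 0 ≤ s := (le_max_left _ _).trans hs.le
  have hcs : c < 1 + s := by linarith [(le_max_right 0 (c - 1)).trans_lt hs]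
  refine ⟨s, hs0, hs1, ?_⟩
  have hne : (1 : ℂ) - s ≠ 0 := by
    exact_mod_cast (sub_pos.2 hs1).ne'
  let F : ℂ × ℂ → ℝ := fun p => ‖(p.1 - s) / (1 - s * p.1) - (p.2 - s) / (1 - s * p.2)‖
  have hF : ContinuousAt F (1, 0) := by
    have h1 : ContinuousAt (fun p : ℂ × ℂ => (p.1 - s) / (1 - s * p.1)) (1, 0) :=
      ContinuousAt.div (by fun_prop) (by fun_prop) (by simpa using hne)
    have h2 : ContinuousAt (fun p : ℂ × ℂ => (p.2 - s) / (1 - s * p.2)) (1, 0) :=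
      ContinuousAt.div (by fun_prop) (by fun_prop) (by simp)
    exact (h1.sub h2).norm
  have hval : F (1, 0) = 1 + s := by
    have : (1 : ℂ) + s = ((1 + s : ℝ) : ℂ) := by push_cast; ring
    simp only [F, mul_one, mul_zero, sub_zero, div_one, zero_sub, div_self hne, sub_neg_eq_add]
    rw [this, Complex.norm_real, Real.norm_of_nonneg (by linarith)]
  obtain ⟨δ, hδ, H⟩ := Metric.eventually_nhds_iff.1
    (hF.eventually (lt_mem_nhds (show c < F (1, 0) by rwa [hval])))
  refine ⟨δ, hδ, fun z w hz hw => H (y := (z, w)) ?_⟩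
  rw [Prod.dist_eq]
  exact max_lt (by rwa [dist_eq_norm]) (by rwa [dist_zero_right])

/-- If elements of the open unit ball of `A` take modulus close to `1` at `φ` and close to `0` at
`ψ`, then `φ` and `ψ` are at maximal distance. -/
lemma norm_charDual_sub_eq_two {A : Subalgebra ℂ C(X, ℂ)} (hA : IsUniformAlgebra A)
    {φ ψ : characterSpace ℂ A}
    (h : ∀ δ : ℝ, 0 < δ → ∃ f : A, ‖f‖ < 1 ∧ 1 - δ < ‖φ f‖ ∧ ‖ψ f‖ < δ) :
    ‖charDual φ - charDual ψ‖ = 2 := by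
  refine le_antisymm (norm_charDual_sub_le_two hA φ ψ) (le_of_forall_lt fun c hc => ?_)
  obtain ⟨s, hs0, hs1, δ, hδ, H⟩ := exists_moebius_difference_gt hc
  obtain ⟨f, hf, hφf, hψf⟩ := h (min δ 1) (lt_min hδ one_pos)
  have hφ0 : 0 < ‖φ f‖ := by linarith [min_le_right δ 1]
  have hφ1 : ‖φ f‖ < 1 := (norm_apply_le_norm_of_character hA φ f).trans_lt hf
  set u : ℂ := ‖φ f‖ / φ f with hu
  have hu1 : ‖u‖ = 1 := by
    rw [hu, norm_div, Complex.norm_real, norm_norm, div_self hφ0.ne']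
  have hz : φ (u • f) = (‖φ f‖ : ℂ) := by
    rw [map_smul, smul_eq_mul, hu, div_mul_cancel₀ _ (norm_pos_iff.1 hφ0)]
  refine (H (φ (u • f)) (ψ (u • f)) ?_ ?_).trans_le
    (norm_moebius_sub_le_norm_charDual_sub hA φ ψ (by rwa [norm_smul, hu1, one_mul]) hs0 hs1)
  · rw [hz, ← Complex.ofReal_one, ← Complex.ofReal_sub, Complex.norm_real, Real.norm_eq_abs,
      abs_lt]
    constructor <;> linarith [min_le_left δ 1]
  · rw [map_smul, smul_eq_mul, norm_mul, hu1, one_mul]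
    exact hψf.trans_le (min_le_left _ _)

lemma exists_mem_ker_notMem_ker {A : Subalgebra ℂ C(X, ℂ)} {φ ψ : characterSpace ℂ A}
    (hne : φ ≠ ψ) : ∃ g : A, ψ g = 0 ∧ φ g ≠ 0 := by
  obtain ⟨g, hg⟩ := DFunLike.ne_iff.1 hne
  exact ⟨g - algebraMap ℂ A (ψ g), by simp [AlgHomClass.commutes],
    by simpa [AlgHomClass.commutes] using sub_ne_zero.2 hg⟩

lemma subset_closure_pow_two_pow {R : Type*} [CommRing R] [TopologicalSpace R]
    [IsTopologicalRing R] {J : Ideal R}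
    (hdense : (J : Set R) ⊆ closure {g : R | ∃ f ∈ J, g = f ^ 2}) (n : ℕ) :
    (J : Set R) ⊆ closure {g : R | ∃ f ∈ J, g = f ^ 2 ^ n} := by
  induction n with
  | zero => exact fun f hf => subset_closure ⟨f, hf, by simp⟩
  | succ n ih =>
    refine ih.trans (closure_minimal ?_ isClosed_closure)
    rintro _ ⟨f, hf, rfl⟩
    refine map_mem_closure (f := fun g : R => g ^ 2 ^ n) (continuous_pow _) (hdense hf) ?_
    rintro _ ⟨g, hg, rfl⟩
    exact ⟨g, hg, by rw [pow_succ' 2 n, pow_mul]⟩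

lemma exists_norm_lt_one_of_dense_squares
    {A : Subalgebra ℂ C(X, ℂ)} {J : Ideal A} (hdense : (J : Set A) ⊆ closure {g : A | ∃ f ∈ J, g = f ^ 2})
    {φ ψ : characterSpace ℂ A} (hne : φ ≠ ψ) (hφ : ∃ f ∈ J, φ f ≠ 0) {δ : ℝ} (hδ : 0 < δ) :
    ∃ f : A, ‖f‖ < 1 ∧ 1 - δ < ‖φ f‖ ∧ ‖ψ f‖ < δ := by
  obtain ⟨f₀, hf₀, hφf₀⟩ := hφ
  obtain ⟨g, hψg, hφg⟩ := exists_mem_ker_notMem_ker hne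
  let t : ℝ := (‖g * f₀‖ + 1)⁻¹
  have ht : 0 < t := by positivity
  let h : A := (t : ℂ) • (g * f₀)
  have hJ : h ∈ J := Submodule.smul_of_tower_mem J _ (J.mul_mem_left g hf₀)
  have hψh : ψ h = 0 := by
    rw [map_smul, map_mul, hψg, zero_mul, smul_zero]
  have hφh : 0 < ‖φ h‖ := by
    rw [norm_pos_iff]
    simp only [h, map_smul, map_mul, smul_eq_mul]
    exact mul_ne_zero (by exact_mod_cast ht.ne') (mul_ne_zero hφg hφf₀)
  have hh : ‖h‖ < 1 := by
    rw [norm_smul, Complex.norm_real, Real.norm_of_nonneg ht.le, inv_mul_lt_one₀ (by positivity)]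
    linarith
  obtain ⟨n, hn⟩ : ∃ n : ℕ, max (1 - δ) 0 ^ 2 ^ n < ‖φ h‖ := by
    obtain ⟨n, hn⟩ := exists_pow_lt_of_lt_one hφh (max_lt (by linarith : 1 - δ < 1) one_pos)
    exact ⟨n, (pow_le_pow_of_le_one (le_max_right _ _) (max_le (by linarith) zero_le_one)
      Nat.lt_two_pow_self.le).trans_lt hn⟩
  have hopen : IsOpen {a : A | ‖a‖ < 1 ∧ max (1 - δ) 0 ^ 2 ^ n < ‖φ a‖ ∧ ‖ψ a‖ < δ ^ 2 ^ n} :=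
    (isOpen_lt continuous_norm continuous_const).inter
      ((isOpen_lt continuous_const (map_continuous φ).norm).inter
        (isOpen_lt (map_continuous ψ).norm continuous_const))
  obtain ⟨_, ⟨ha, hφa, hψa⟩, f, -, rfl⟩ := mem_closure_iff.1
    (subset_closure_pow_two_pow hdense n hJ) _ hopen ⟨hh, hn, by rw [hψh, norm_zero]; positivity⟩
  rw [map_pow, norm_pow] at hφa hψa
  exact ⟨f, norm_lt_one_of_norm_pow_lt_one ha,
    (le_max_left _ _).trans_lt (lt_of_pow_lt_pow_left₀ _ (norm_nonneg _) hφa),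
    lt_of_pow_lt_pow_left₀ _ hδ.le hψa⟩

/-- If a uniform algebra has a primary ideal `J` (contained in the
kernel of exactly one character) such that `{f² : f ∈ J}` is dense in `J`, then every
point of the maximal ideal space is a one-point Gleason part. -/
theorem one_point_parts_of_primary_ideal_with_dense_squares
    {X : Type*} [TopologicalSpace X] [CompactSpace X] [T2Space X]
    (A : Subalgebra ℂ C(X, ℂ)) (hA : IsUniformAlgebra A)
    (J : Ideal A) (φ₀ : characterSpace ℂ A)
    (hsub : ∀ f ∈ J, φ₀ f = 0)
    (huniq : ∀ ψ : characterSpace ℂ A, (∀ f ∈ J, ψ f = 0) → ψ = φ₀)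
    (hdense : (J : Set A) ⊆ closure {g : A | ∃ f ∈ J, g = f ^ 2}) :
    ∀ φ ψ : characterSpace ℂ A, φ ≠ ψ → ‖charDual φ - charDual ψ‖ = 2 := by
  intro φ ψ hne
  have key : ∀ φ ψ : characterSpace ℂ A, φ ≠ ψ → φ ≠ φ₀ → ‖charDual φ - charDual ψ‖ = 2 := by
    intro φ ψ hne hφ
    have hJ : ∃ f ∈ J, φ f ≠ 0 := by
      by_contra! hJ
      exact hφ (huniq φ hJ)
    exact norm_charDual_sub_eq_two hA fun δ hδ =>
      exists_norm_lt_one_of_dense_squares hdense hne hJ hδ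
  by_cases hφ : φ = φ₀
  · exact (norm_sub_rev (charDual φ) (charDual ψ)).trans
      (key ψ φ hne.symm fun hψ => hne (hφ.trans hψ.symm))
  · exact key φ ψ hne hφ

end
end
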